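/- (Claim 2) Let k ≥ 3 and n ≥ 2k+1, and let c be an edge coloring of the complete graph K_n. Suppose there exist disjoint vertex sets U and W with |U| = 2k-3 and |W| = 3, and a set E₀ of edges of K_n which is either (i) all edges inside U together with two edges inside W sharing a common vertex (a path P₃ on W), or (ii) all edges inside U except one together with all three edges inside W, such that the edges of E₀ have pairwise distinct colors under c and every edge of K_n receives the same color as some edge of E₀. Then K_n contains a rainbow matching of size k. -/

import Mathlib

/-- The number of colors used by an edge coloring `c` of the complete graph on `Fin n`:
the cardinality of the image of `c` on the edge set. -/
def numColors {n : ℕ} (c : Sym2 (Fin n) → ℕ) : ℕ :=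
  (((⊤ : SimpleGraph (Fin n)).edgeFinset).image c).card

/-- The coloring `c` of the complete graph on `Fin n` admits a rainbow matching of size `k`:
`k` pairwise disjoint edges with pairwise distinct colors. -/
def HasRainbowMatching {n : ℕ} (c : Sym2 (Fin n) → ℕ) (k : ℕ) : Prop :=
  ∃ s : Finset (Sym2 (Fin n)), s.card = k ∧ (∀ e ∈ s, ¬ e.IsDiag) ∧
    ((s : Set (Sym2 (Fin n))).Pairwise fun e f => ∀ v, v ∈ e → v ∉ f) ∧
    Set.InjOn c ↑s
/-- The set of edges of the complete graph on `Fin n` lying inside the vertex set `U`. -/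
def edgesInside {n : ℕ} (U : Finset (Fin n)) : Set (Sym2 (Fin n)) :=
  {e | ¬ e.IsDiag ∧ ∀ v ∈ e, v ∈ U}

/-- `M` is a matching of size `m` all of whose edges lie inside the vertex set `S`. -/
def IsMatchingInside {n : ℕ} (S : Finset (Fin n)) (m : ℕ) (M : Finset (Sym2 (Fin n))) : Prop :=
  M.card = m ∧ (∀ e ∈ M, e ∈ edgesInside S) ∧
    (M : Set (Sym2 (Fin n))).Pairwise fun e f => ∀ v, v ∈ e → v ∉ f

theorem mk_mem_edgesInside {n : ℕ} {S : Finset (Fin n)} {x y : Fin n} :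
    s(x, y) ∈ edgesInside S ↔ x ≠ y ∧ x ∈ S ∧ y ∈ S := by
  simp [edgesInside]

theorem IsMatchingInside.insert_edge {n : ℕ} {S T : Finset (Fin n)} {m : ℕ}
    {M : Finset (Sym2 (Fin n))} (hM : IsMatchingInside T m M) (hTS : T ⊆ S) {x y : Fin n}
    (hxy : x ≠ y) (hx : x ∈ S) (hy : y ∈ S) (hxT : x ∉ T) (hyT : y ∉ T) :
    IsMatchingInside S (m + 1) (insert s(x, y) M) := by
  obtain ⟨hcard, hin, hdisj⟩ := hM
  have hnot : s(x, y) ∉ M := fun h => hxT ((hin _ h).2 x (Sym2.mem_mk_left x y))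
  refine ⟨by rw [Finset.card_insert_of_notMem hnot, hcard], ?_, ?_⟩
  · intro e he
    rcases Finset.mem_insert.1 he with rfl | he
    · exact mk_mem_edgesInside.2 ⟨hxy, hx, hy⟩
    · exact ⟨(hin e he).1, fun v hv => hTS ((hin e he).2 v hv)⟩
  · rw [Finset.coe_insert, Set.pairwise_insert]
    refine ⟨hdisj, fun f hf _ => ⟨fun v hv hvf => ?_, fun v hvf hv => ?_⟩⟩ <;>
    · have := (hin f hf).2 v hvf
      rcases Sym2.mem_iff.1 hv with rfl | rfl <;> contradiction

/-- If every large enough subset of `S` contains an edge outside `B`, then picking edges greedily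
gives a matching inside `S` avoiding `B`. -/
theorem exists_isMatchingInside {n : ℕ} (r : ℕ) (B : Set (Sym2 (Fin n))) (m : ℕ)
    (S : Finset (Fin n)) (hS : 2 * m + r ≤ S.card)
    (hB : ∀ T ⊆ S, r + 2 ≤ T.card → ∃ x ∈ T, ∃ y ∈ T, x ≠ y ∧ s(x, y) ∉ B) :
    ∃ M, IsMatchingInside S m M ∧ ∀ e ∈ M, e ∉ B := by
  induction m generalizing S with
  | zero => exact ⟨∅, by simp [IsMatchingInside], by simp⟩
  | succ m ih =>
    obtain ⟨x, hx, y, hy, hxy, hxyB⟩ := hB S subset_rfl (by omega)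
    have hsub : S \ {x, y} ⊆ S := Finset.sdiff_subset
    have hcard : S.card - 2 ≤ (S \ {x, y}).card := by
      have := Finset.le_card_sdiff {x, y} S
      rwa [Finset.card_pair hxy] at this
    obtain ⟨M, hM, hMB⟩ := ih (S \ {x, y}) (by omega) fun T hT => hB T (hT.trans hsub)
    refine ⟨_, hM.insert_edge hsub hxy hx hy (by simp) (by simp), ?_⟩
    simpa [hxyB] using hMB

theorem exists_isMatchingInside_avoiding_two {n : ℕ} (e f : Sym2 (Fin n)) (m : ℕ)
    (S : Finset (Fin n)) (hS : 2 * m + 1 ≤ S.card) :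
    ∃ M, IsMatchingInside S m M ∧ e ∉ M ∧ f ∉ M := by
  obtain ⟨M, hM, hMB⟩ := exists_isMatchingInside 1 {e, f} m S hS fun T _ hT => by
    obtain ⟨x, hx, y, hy, z, hz, hxy, hxz, hyz⟩ := Finset.two_lt_card.1 hT
    by_contra! h
    have h₁ := h x hx y hy hxy
    have h₂ := h x hx z hz hxz
    have h₃ := h y hy z hz hyz
    simp only [Set.mem_insert_iff, Set.mem_singleton_iff] at h₁ h₂ h₃
    have h₄ : s(x, y) ≠ s(x, z) := by simp [hyz, hxz]
    have h₅ : s(x, y) ≠ s(y, z) := by simp [hxy, hxz]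
    have h₆ : s(x, z) ≠ s(y, z) := by simp [hxy, hxz]
    grind
  exact ⟨M, hM, fun h => hMB e h (by simp), fun h => hMB f h (by simp)⟩

theorem exists_isMatchingInside_avoiding {n : ℕ} (f : Sym2 (Fin n)) (m : ℕ) (hm : 2 ≤ m)
    (S : Finset (Fin n)) (hS : 2 * m ≤ S.card) :
    ∃ M, IsMatchingInside S m M ∧ f ∉ M := by
  have key (l : ℕ) (T : Finset (Fin n)) (hT : 2 * l ≤ T.card) : ∃ M, IsMatchingInside T l M := by
    obtain ⟨M, hM, -⟩ := exists_isMatchingInside 0 ∅ l T hT fun T' _ hT' => by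
      obtain ⟨x, hx, y, hy, hxy⟩ := Finset.one_lt_card.1 (Nat.lt_of_succ_le hT')
      exact ⟨x, hx, y, hy, hxy, by simp⟩
    exact ⟨M, hM⟩
  by_cases hf : ∃ x ∈ S, x ∈ f
  · obtain ⟨x, hx, x', rfl⟩ := hf
    have hcard := Finset.le_card_sdiff {x, x'} S
    have hle := Finset.card_le_two (a := x) (b := x')
    obtain ⟨y, hy⟩ := Finset.card_pos.1 (show 0 < (S \ {x, x'}).card by omega)
    simp only [Finset.mem_sdiff, Finset.mem_insert, Finset.mem_singleton, not_or] at hy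
    obtain ⟨hyS, hyx, hyx'⟩ := hy
    have hcard' := Finset.le_card_sdiff {x, y} S
    have hle' := Finset.card_le_two (a := x) (b := y)
    obtain ⟨l, rfl⟩ : ∃ l, m = l + 1 := ⟨m - 1, by omega⟩
    obtain ⟨M, hM⟩ := key l (S \ {x, y}) (by omega)
    refine ⟨_, hM.insert_edge Finset.sdiff_subset (Ne.symm hyx) hx hyS (by simp) (by simp), ?_⟩
    rw [Finset.mem_insert, not_or]
    refine ⟨by simp [Ne.symm hyx, Ne.symm hyx'], fun h => ?_⟩
    have := (hM.2.1 _ h).2 x (Sym2.mem_mk_left x x')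
    simp at this
  · obtain ⟨M, hM⟩ := key m S hS
    refine ⟨M, hM, fun h => hf ?_⟩
    exact ⟨f.out.1, (hM.2.1 f h).2 _ (Sym2.out_fst_mem f), Sym2.out_fst_mem f⟩

/-- A rainbow matching inside `S` extends by two disjoint edges outside `S` of new colors. -/
theorem IsMatchingInside.hasRainbowMatching {n : ℕ} {c : Sym2 (Fin n) → ℕ}
    {S : Finset (Fin n)} {m : ℕ} {M : Finset (Sym2 (Fin n))} (hM : IsMatchingInside S m M)
    (hinj : Set.InjOn c M) {p q x y : Fin n} (hnd : [p, q, x, y].Nodup)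
    (hp : p ∉ S) (hq : q ∉ S) (hx : x ∉ S) (hy : y ∉ S)
    (hne : c s(p, q) ≠ c s(x, y)) (hpq : ∀ e ∈ M, c e ≠ c s(p, q))
    (hxy : ∀ e ∈ M, c e ≠ c s(x, y)) : HasRainbowMatching c (m + 2) := by
  simp only [List.nodup_cons, List.mem_cons, List.not_mem_nil, or_false, not_or] at hnd
  obtain ⟨⟨h₁, h₂, h₃⟩, ⟨h₄, h₅⟩, h₆, -⟩ := hnd
  have hM₁ : IsMatchingInside (S ∪ {x, y}) (m + 1) (insert s(x, y) M) :=
    hM.insert_edge Finset.subset_union_left h₆ (by simp) (by simp) hx hy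
  have hM₂ : IsMatchingInside Finset.univ (m + 2) (insert s(p, q) (insert s(x, y) M)) :=
    hM₁.insert_edge (Finset.subset_univ _) h₁ (Finset.mem_univ _) (Finset.mem_univ _)
      (by simp [hp, h₂, h₃]) (by simp [hq, h₄, h₅])
  refine ⟨_, hM₂.1, fun e he => (hM₂.2.1 e he).1, hM₂.2.2, ?_⟩
  have hxyM : s(x, y) ∉ M := fun h => hxy _ h rfl
  have hpqM : s(p, q) ∉ M := fun h => hpq _ h rfl
  have hpqxy : s(p, q) ≠ s(x, y) := fun h => hne (congrArg c h)
  rw [Finset.coe_insert, Set.injOn_insert (by simp [hpqM, hpqxy]), Finset.coe_insert,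
    Set.injOn_insert (by simpa using hxyM)]
  refine ⟨⟨hinj, ?_⟩, ?_⟩
  · rintro ⟨e, he, h⟩
    exact hxy e he h
  · rintro ⟨e, he, h⟩
    rcases he with rfl | he
    · exact hne h.symm
    · exact hpq e he h

/-- Let `c` be injective on the edges inside `U` other than `e₁`. If `S ⊆ U` has, for every `g`, a
matching of size `m` avoiding `e₁` and `g`, then any two disjoint edges outside `S` of distinct
colors, one of which does not appear on the edges inside `U` other than `e₁`, give a rainbow
matching of size `m + 2`. -/
theorem hasRainbowMatching_of_avoiding {n : ℕ} {c : Sym2 (Fin n) → ℕ}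
    {U S : Finset (Fin n)} (hSU : S ⊆ U) {e₁ : Sym2 (Fin n)} {m : ℕ}
    (hinj : Set.InjOn c (edgesInside U \ {e₁}))
    (hM : ∀ g, ∃ M, IsMatchingInside S m M ∧ e₁ ∉ M ∧ g ∉ M)
    {p q x y : Fin n} (hnd : [p, q, x, y].Nodup)
    (hp : p ∉ S) (hq : q ∉ S) (hx : x ∉ S) (hy : y ∉ S)
    (hne : c s(p, q) ≠ c s(x, y)) (hxy : ∀ e ∈ edgesInside U \ {e₁}, c e ≠ c s(x, y)) :
    HasRainbowMatching c (m + 2) := by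
  have hsub {M : Finset (Sym2 (Fin n))} (h : IsMatchingInside S m M) (h₁ : e₁ ∉ M) :
      ∀ e ∈ M, e ∈ edgesInside U \ {e₁} := fun e he =>
    ⟨⟨(h.2.1 e he).1, fun v hv => hSU ((h.2.1 e he).2 v hv)⟩, fun h' => h₁ (h' ▸ he)⟩
  by_cases hg : ∃ g ∈ edgesInside U \ {e₁}, c g = c s(p, q)
  · obtain ⟨g, hgG, hgc⟩ := hg
    obtain ⟨M, h, h₁, hgM⟩ := hM g
    refine h.hasRainbowMatching (hinj.mono (hsub h h₁)) hnd hp hq hx hy hne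
      (fun e he hec => hgM ?_) fun e he => hxy e (hsub h h₁ e he)
    rwa [hinj hgG (hsub h h₁ e he) (hgc.trans hec.symm)]
  · push Not at hg
    obtain ⟨M, h, h₁, -⟩ := hM e₁
    exact h.hasRainbowMatching (hinj.mono (hsub h h₁)) hnd hp hq hx hy hne
      (fun e he => hg e (hsub h h₁ e he)) fun e he => hxy e (hsub h h₁ e he)

/-- The common core of both configurations: only the path `w₁ w₂ w₃` and the edges inside `U` other
than `s(u₁, u₂)` are needed. -/
theorem hasRainbowMatching_of_path {n m : ℕ} (hm : 1 ≤ m) {c : Sym2 (Fin n) → ℕ}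
    {U : Finset (Fin n)} (hU : U.card = 2 * m + 1) {u₁ u₂ w₁ w₂ w₃ z : Fin n}
    (hu₁ : u₁ ∈ U) (hu₂ : u₂ ∈ U) (hu : u₁ ≠ u₂) (hnd : [w₁, w₂, w₃, z].Nodup)
    (hw₁ : w₁ ∉ U) (hw₂ : w₂ ∉ U) (hw₃ : w₃ ∉ U) (hz : z ∉ U)
    (hinj : Set.InjOn c (edgesInside U \ {s(u₁, u₂)}))
    (ha : ∀ e ∈ edgesInside U \ {s(u₁, u₂)}, c e ≠ c s(w₁, w₂))
    (hb : ∀ e ∈ edgesInside U \ {s(u₁, u₂)}, c e ≠ c s(w₂, w₃))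
    (hab : c s(w₁, w₂) ≠ c s(w₂, w₃)) : HasRainbowMatching c (m + 2) := by
  by_contra hcon
  simp only [List.nodup_cons, List.mem_cons, List.not_mem_nil, or_false, not_or] at hnd
  obtain ⟨⟨h₁₂, h₁₃, h₁z⟩, ⟨h₂₃, h₂z⟩, h₃z, -⟩ := hnd
  have hfull (g : Sym2 (Fin n)) :=
    exists_isMatchingInside_avoiding_two s(u₁, u₂) g m U hU.ge
  have hza : c s(z, w₃) = c s(w₁, w₂) := by
    by_contra h
    exact hcon (hasRainbowMatching_of_avoiding subset_rfl hinj hfull (by grind) hz hw₃ hw₁ hw₂ h ha)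
  have hzb : c s(z, w₁) = c s(w₂, w₃) := by
    by_contra h
    exact hcon (hasRainbowMatching_of_avoiding subset_rfl hinj hfull (by grind) hz hw₁ hw₂ hw₃ h hb)
  have hne {u v : Fin n} (hu : u ∈ U) (hv : v ∉ U) : u ≠ v := fun h => hv (h ▸ hu)
  have h₁w₁ := hne hu₁ hw₁
  have h₁w₂ := hne hu₁ hw₂
  have h₁w₃ := hne hu₁ hw₃
  have h₁z := hne hu₁ hz
  have h₂w₁ := hne hu₂ hw₁
  have h₂w₂ := hne hu₂ hw₂
  have h₂w₃ := hne hu₂ hw₃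
  have h₂z := hne hu₂ hz
  rcases hm.eq_or_lt with rfl | hm
  · obtain ⟨u₃, hu₃, h₃⟩ : ∃ u₃ ∈ U, u₃ ∉ ({u₁, u₂} : Finset (Fin n)) :=
      Finset.exists_mem_notMem_of_card_lt_card (by rw [Finset.card_pair hu]; omega)
    simp only [Finset.mem_insert, Finset.mem_singleton, not_or] at h₃
    obtain ⟨h₃₁, h₃₂⟩ := h₃
    have h₃w₁ := hne hu₃ hw₁
    have h₃w₂ := hne hu₃ hw₂
    have h₃w₃ := hne hu₃ hw₃
    have h₃z' := hne hu₃ hz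
    have hG₁ : s(u₂, u₃) ∈ edgesInside U \ {s(u₁, u₂)} :=
      ⟨mk_mem_edgesInside.2 ⟨Ne.symm h₃₂, hu₂, hu₃⟩, by simp [h₃₁, h₃₂, Ne.symm hu]⟩
    have hG₂ : s(u₁, u₃) ∈ edgesInside U \ {s(u₁, u₂)} :=
      ⟨mk_mem_edgesInside.2 ⟨Ne.symm h₃₁, hu₁, hu₃⟩, by simp [hu, h₃₁, h₃₂]⟩
    have n₁ : [u₂, u₃, u₁, w₁, w₂, w₃].Nodup := by simp; grind only
    have n₂ : [u₂, u₃, u₁, w₁, z, w₃].Nodup := by simp; grind only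
    have n₃ : [u₁, u₃, u₂, w₂, z, w₁].Nodup := by simp; grind only
    have n₄ : [u₁, u₃, u₂, w₂, z, w₃].Nodup := by simp; grind only
    have n₅ : [u₁, w₁, u₂, w₂, z, w₃].Nodup := by simp; grind only
    have three {r s p q x y : Fin n} (h : [r, s, p, q, x, y].Nodup)
        (h₁ : c s(r, s) ≠ c s(p, q)) (h₂ : c s(r, s) ≠ c s(x, y))
        (h₃ : c s(p, q) ≠ c s(x, y)) : False := by
      have hM : IsMatchingInside {r, s} 1 {s(r, s)} := by
        refine ⟨by simp, ?_, by simp⟩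
        simp only [Finset.mem_singleton, forall_eq]
        exact mk_mem_edgesInside.2 ⟨by grind, by simp, by simp⟩
      refine hcon (hM.hasRainbowMatching (by simp) (p := p) (q := q) (x := x) (y := y)
        (by grind) ?_ ?_ ?_ ?_ h₃ (by simpa using h₁) (by simpa using h₂)) <;> grind
    have hc₁ : c s(u₂, u₃) = c s(u₁, w₁) := by
      by_contra h
      by_cases h' : c s(u₁, w₁) = c s(w₁, w₂)
      · exact three n₁ h (hb _ hG₁) (h' ▸ hab)
      · exact three n₂ h (hza ▸ ha _ hG₁) (hza ▸ h')
    have hc₂ : c s(u₁, u₃) = c s(u₂, w₂) := by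
      by_contra h
      by_cases h' : c s(u₂, w₂) = c s(w₁, w₂)
      · exact three n₃ h (hzb ▸ hb _ hG₂) (by rw [h', hzb]; exact hab)
      · exact three n₄ h (hza ▸ ha _ hG₂) (hza ▸ h')
    refine three n₅ ?_
      (hza ▸ hc₁ ▸ ha _ hG₁) (hza ▸ hc₂ ▸ ha _ hG₂)
    rw [← hc₁, ← hc₂]
    intro h
    have := hinj hG₁ hG₂ h
    simp [h₃₁, Ne.symm hu] at this
  · have hsub : U.erase u₁ ⊆ U := Finset.erase_subset _ _
    have hav (g : Sym2 (Fin n)) :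
        ∃ M, IsMatchingInside (U.erase u₁) m M ∧ s(u₁, u₂) ∉ M ∧ g ∉ M := by
      obtain ⟨M, hM, hg⟩ := exists_isMatchingInside_avoiding g m hm (U.erase u₁)
        (by rw [Finset.card_erase_of_mem hu₁]; omega)
      refine ⟨M, hM, fun h => ?_, hg⟩
      simpa using (hM.2.1 _ h).2 u₁ (Sym2.mem_mk_left u₁ u₂)
    have hout {v : Fin n} (hv : v ∉ U) : v ∉ U.erase u₁ := fun h => hv (hsub h)
    refine hcon ?_
    by_cases h' : c s(u₁, w₁) = c s(w₁, w₂)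
    · exact hasRainbowMatching_of_avoiding hsub hinj hav (by grind) (by simp) (hout hw₁)
        (hout hw₂) (hout hw₃) (h' ▸ hab) hb
    · exact hasRainbowMatching_of_avoiding hsub hinj hav (by grind) (by simp) (hout hw₁)
        (hout hz) (hout hw₃) (hza ▸ h') (hza ▸ ha)

/-- Claim 2: let `k ≥ 3`, `n ≥ 2k+1` and let `c` be an edge coloring of `K_n`. Suppose
there are disjoint vertex sets `U`, `W` with `|U| = 2k-3` and `|W| = 3`, and a set `E₀`
of edges which is either (i) all edges inside `U` together with two edges inside `W`
sharing a common vertex, or (ii) all edges inside `U` except one together with all three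
edges inside `W`, such that the edges of `E₀` have pairwise distinct colors and every
edge of `K_n` has the same color as some edge of `E₀`. Then `K_n` contains a rainbow
matching of size `k`. -/
theorem claim_two (n k : ℕ) (hk : 3 ≤ k) (hn : 2 * k + 1 ≤ n) (c : Sym2 (Fin n) → ℕ)
    (U W : Finset (Fin n)) (hUW : Disjoint U W)
    (hU : U.card = 2 * k - 3) (hW : W.card = 3)
    (E₀ : Set (Sym2 (Fin n)))
    (hE₀ :
      (∃ w₁ w₂ w₃ : Fin n, W = {w₁, w₂, w₃} ∧ w₁ ≠ w₂ ∧ w₂ ≠ w₃ ∧ w₁ ≠ w₃ ∧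
        E₀ = edgesInside U ∪ {s(w₁, w₂), s(w₂, w₃)}) ∨
      (∃ e₁ ∈ edgesInside U, E₀ = edgesInside U \ {e₁} ∪ edgesInside W))
    (hinj : Set.InjOn c E₀)
    (hrep : ∀ e : Sym2 (Fin n), ¬ e.IsDiag → ∃ e' ∈ E₀, c e = c e') :
    HasRainbowMatching c k := by
  obtain ⟨z, hz⟩ : ∃ z, z ∉ U ∪ W := by
    by_contra! h
    have h₁ := Finset.card_union_of_disjoint hUW
    rw [Finset.eq_univ_of_forall h, Finset.card_univ, Fintype.card_fin] at h₁
    omega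
  rw [Finset.mem_union, not_or] at hz
  obtain ⟨m, rfl⟩ : ∃ m, k = m + 2 := ⟨k - 2, by omega⟩
  have hm : 1 ≤ m := by omega
  have hU' : U.card = 2 * m + 1 := by omega
  have hWU {w : Fin n} (hw : w ∈ W) : w ∉ U := Finset.disjoint_right.1 hUW hw
  obtain ⟨w₁, w₂, w₃, u₁, u₂, rfl, h₁₂, h₂₃, h₁₃, hu, hu₁, hu₂, hE⟩ :
      ∃ w₁ w₂ w₃ u₁ u₂ : Fin n, W = {w₁, w₂, w₃} ∧ w₁ ≠ w₂ ∧ w₂ ≠ w₃ ∧ w₁ ≠ w₃ ∧ u₁ ≠ u₂ ∧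
        u₁ ∈ U ∧ u₂ ∈ U ∧ edgesInside U \ {s(u₁, u₂)} ∪ {s(w₁, w₂), s(w₂, w₃)} ⊆ E₀ := by
    rcases hE₀ with ⟨w₁, w₂, w₃, rfl, h₁₂, h₂₃, h₁₃, rfl⟩ | ⟨e₁, he₁, rfl⟩
    · obtain ⟨u₁, hu₁, u₂, hu₂, hu⟩ := Finset.one_lt_card.1 (show 1 < U.card by omega)
      exact ⟨w₁, w₂, w₃, u₁, u₂, rfl, h₁₂, h₂₃, h₁₃, hu, hu₁, hu₂,
        Set.union_subset_union_left _ Set.sdiff_subset⟩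
    · obtain ⟨w₁, w₂, w₃, h₁₂, h₁₃, h₂₃, rfl⟩ := Finset.card_eq_three.1 hW
      induction e₁ with | _ u₁ u₂
      obtain ⟨hu, hu₁, hu₂⟩ := mk_mem_edgesInside.1 he₁
      refine ⟨w₁, w₂, w₃, u₁, u₂, rfl, h₁₂, h₂₃, h₁₃, hu, hu₁, hu₂,
        Set.union_subset_union_right _ ?_⟩
      rintro e (rfl | rfl) <;> rw [mk_mem_edgesInside] <;> simp [h₁₂, h₂₃]
  have hw₁ : w₁ ∉ U := hWU (by simp)
  have hw₂ : w₂ ∉ U := hWU (by simp)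
  have hw₃ : w₃ ∉ U := hWU (by simp)
  have hG : edgesInside U \ {s(u₁, u₂)} ⊆ E₀ := Set.subset_union_left.trans hE
  have haE : s(w₁, w₂) ∈ E₀ := hE (by simp)
  have hbE : s(w₂, w₃) ∈ E₀ := hE (by simp)
  have hnd : [w₁, w₂, w₃, z].Nodup := by simp at hz; grind
  refine hasRainbowMatching_of_path hm hU' hu₁ hu₂ hu hnd hw₁ hw₂ hw₃ hz.1
    (hinj.mono hG) (fun e he h => ?_) (fun e he h => ?_) fun h => ?_
  · rw [hinj (hG he) haE h] at he
    exact hw₁ (mk_mem_edgesInside.1 he.1).2.1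
  · rw [hinj (hG he) hbE h] at he
    exact hw₂ (mk_mem_edgesInside.1 he.1).2.1
  · have := hinj haE hbE h
    simp [h₁₂, h₁₃] at this
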